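/- arXiv:2007.12243 — 2 statements merged into one kernel-verified Lean document; each statement's English description precedes it below -/
import Mathlib

section
/- Let F be a field of characteristic ≠ 2. Then every centrally essential non-unital F-subalgebra of N₄(F), the algebra of strictly upper triangular 4×4 matrices over F, is commutative. -/
/-- A (not necessarily unital) ring is *centrally essential* if either it is commutative, or
for every non-central element `a` there exist nonzero central elements `x`, `y` with
`a * x = y`. -/
def IsCentrallyEssential (R : Type*) [NonUnitalNonAssocRing R] : Prop :=
  (∀ a b : R, a * b = b * a) ∨
    ∀ a : R, ¬ (∀ b : R, a * b = b * a) →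
      ∃ x y : R, (∀ b : R, x * b = b * x) ∧ (∀ b : R, y * b = b * y) ∧
        x ≠ 0 ∧ y ≠ 0 ∧ a * x = y

theorem n4_mul {F : Type*} [Field F] (A B : Matrix (Fin 4) (Fin 4) F)
    (hA : ∀ i j : Fin 4, j ≤ i → A i j = 0) (hB : ∀ i j : Fin 4, j ≤ i → B i j = 0) :
    A * B = !![0, 0, A 0 1 * B 1 2, A 0 1 * B 1 3 + A 0 2 * B 2 3;
               0, 0, 0, A 1 2 * B 2 3; 0, 0, 0, 0; 0, 0, 0, 0] := by
  have a1 := hA 0 0 (by decide)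
  have a2 := hA 1 0 (by decide)
  have a3 := hA 1 1 (by decide)
  have a4 := hA 2 0 (by decide)
  have a5 := hA 2 1 (by decide)
  have a6 := hA 2 2 (by decide)
  have a7 := hA 3 0 (by decide)
  have a8 := hA 3 1 (by decide)
  have a9 := hA 3 2 (by decide)
  have a10 := hA 3 3 (by decide)
  have b1 := hB 0 0 (by decide)
  have b2 := hB 1 0 (by decide)
  have b3 := hB 1 1 (by decide)
  have b4 := hB 2 0 (by decide)
  have b5 := hB 2 1 (by decide)
  have b6 := hB 2 2 (by decide)
  have b7 := hB 3 0 (by decide)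
  have b8 := hB 3 1 (by decide)
  have b9 := hB 3 2 (by decide)
  have b10 := hB 3 3 (by decide)
  ext i j
  fin_cases i <;> fin_cases j <;> simp [Matrix.mul_apply, Fin.sum_univ_four, *]

theorem n4_pfaff {F : Type*} [Field F] (a c e d a' c' e' d' x1 x2 x3 x4 y1 y2 y3 y4 : F)
    (hw : a * e' + c * d' ≠ a' * e + c' * d)
    (hax : a * x3 + c * x4 = x1 * e + x2 * d)
    (hbx : a' * x3 + c' * x4 = x1 * e' + x2 * d')
    (hay : a * y3 + c * y4 = y1 * e + y2 * d)
    (hby : a' * y3 + c' * y4 = y1 * e' + y2 * d')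
    (hxy : x1 * y3 + x2 * y4 = y1 * x3 + y2 * x4)
    (h1 : a * x3 + c * x4 ≠ 0) (h2 : a' * x3 + c' * x4 = 0) (h3 : a' * y3 + c' * y4 ≠ 0) :
    False := by
  have hdet : (!![a, c, e, d; a', c', e', d'; x1, x2, x3, x4; y1, y2, y3, y4] :
      Matrix (Fin 4) (Fin 4) F).det = 0 := by
    simp [Matrix.det_succ_row_zero, Fin.sum_univ_succ, Fin.succAbove]
    grind
  obtain ⟨v, hv, hv0⟩ := Matrix.exists_vecMul_eq_zero_iff.mpr hdet
  have k0 := congrFun hv0 0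
  have k1 := congrFun hv0 1
  have k2 := congrFun hv0 2
  have k3 := congrFun hv0 3
  simp [Matrix.vecMul, dotProduct, Fin.sum_univ_four] at k0 k1 k2 k3
  have hw' : a * e' + c * d' - (a' * e + c' * d) ≠ 0 := sub_ne_zero.mpr hw
  have v1 : v 1 = 0 := by
    have : v 1 * (a * e' + c * d' - (a' * e + c' * d)) = 0 := by
      linear_combination a * k2 + c * k3 - e * k0 - d * k1 - v 2 * hax - v 3 * hay
    simpa [hw'] using this
  have v0 : v 0 = 0 := by
    have : v 0 * (a * e' + c * d' - (a' * e + c' * d)) = 0 := by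
      linear_combination -(a' * k2 + c' * k3 - e' * k0 - d' * k1 - v 2 * hbx - v 3 * hby)
    simpa [hw'] using this
  have v3 : v 3 = 0 := by
    have : v 3 * (a' * y3 + c' * y4) = 0 := by
      rw [v0, v1] at k2 k3
      linear_combination a' * k2 + c' * k3 - v 2 * h2
    simpa [h3] using this
  have v2 : v 2 = 0 := by
    have : v 2 * (a * x3 + c * x4) = 0 := by
      rw [v0, v1, v3] at k2 k3
      linear_combination a * k2 + c * k3
    simpa [h1] using this
  apply hv
  ext i
  fin_cases i <;> simp [*]

theorem centrallyEssential_subalgebra_N4_commutative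
    (F : Type*) [Field F] (hF : ringChar F ≠ 2)
    (S : NonUnitalSubalgebra F (Matrix (Fin 4) (Fin 4) F))
    (hS : ∀ A ∈ S, ∀ i j : Fin 4, j ≤ i → A i j = 0)
    (hce : IsCentrallyEssential S) :
    ∀ a b : S, a * b = b * a := by
  rcases hce with h | hce
  · exact h
  have comm : ∀ A B : S, A * B = B * A ↔
      (A.1 0 1 * B.1 1 2 = B.1 0 1 * A.1 1 2 ∧ A.1 1 2 * B.1 2 3 = B.1 1 2 * A.1 2 3 ∧
       A.1 0 1 * B.1 1 3 + A.1 0 2 * B.1 2 3 = B.1 0 1 * A.1 1 3 + B.1 0 2 * A.1 2 3) := by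
    intro A B
    rw [Subtype.ext_iff]
    simp only [NonUnitalSubalgebra.coe_mul]
    rw [n4_mul _ _ (hS _ A.2) (hS _ B.2), n4_mul _ _ (hS _ B.2) (hS _ A.2)]
    constructor
    · intro h
      refine ⟨?_, ?_, ?_⟩
      · simpa using congrFun (congrFun h 0) 2
      · simpa using congrFun (congrFun h 1) 3
      · simpa using congrFun (congrFun h 0) 3
    · rintro ⟨h1, h2, h3⟩
      rw [h1, h2, h3]
  have nz : ∀ A B : S, A * B ≠ 0 → A.1 0 1 * B.1 1 2 = 0 → A.1 1 2 * B.1 2 3 = 0 →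
       A.1 0 1 * B.1 1 3 + A.1 0 2 * B.1 2 3 ≠ 0 := by
    intro A B h h1 h2 h3
    apply h
    rw [Subtype.ext_iff]
    simp only [NonUnitalSubalgebra.coe_mul]
    rw [n4_mul _ _ (hS _ A.2) (hS _ B.2), h1, h2, h3]
    ext i j
    fin_cases i <;> fin_cases j <;> simp
  have ess : ∀ A : S, ¬ (∀ b : S, A * b = b * A) →
      ∃ x : S, (∀ b : S, x * b = b * x) ∧ A * x ≠ 0 := by
    intro A hA
    obtain ⟨x, y, hx, -, -, hy, h⟩ := hce A hA
    exact ⟨x, hx, h ▸ hy⟩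
  clear hce
  by_cases c1 : ∃ x : S, (∀ b : S, x * b = b * x) ∧ x.1 1 2 ≠ 0
  · obtain ⟨x, hx, hb⟩ := c1
    intro A B
    have hA := (comm _ _).1 (hx A)
    have hB := (comm _ _).1 (hx B)
    have key : ∀ t : F, x.1 1 2 * t = 0 → t = 0 := fun t ht => by simpa [hb] using ht
    obtain ⟨p1, p2, p3⟩ := hA
    obtain ⟨q1, q2, q3⟩ := hB
    obtain ⟨s, hs⟩ : ∃ s, A.1 1 2 = s * x.1 1 2 := ⟨A.1 1 2 / x.1 1 2, by field_simp⟩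
    obtain ⟨t, ht⟩ : ∃ s, B.1 1 2 = s * x.1 1 2 := ⟨B.1 1 2 / x.1 1 2, by field_simp⟩
    have a0 : A.1 0 1 = s * x.1 0 1 := mul_left_cancel₀ hb (by rw [hs] at p1; linear_combination -p1)
    have a2 : A.1 2 3 = s * x.1 2 3 := mul_left_cancel₀ hb (by rw [hs] at p2; linear_combination p2)
    have b0 : B.1 0 1 = t * x.1 0 1 := mul_left_cancel₀ hb (by rw [ht] at q1; linear_combination -q1)
    have b2 : B.1 2 3 = t * x.1 2 3 := mul_left_cancel₀ hb (by rw [ht] at q2; linear_combination q2)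
    rw [comm, hs, ht, a0, a2, b0, b2]
    rw [a0, a2] at p3
    rw [b0, b2] at q3
    refine ⟨by ring, by ring, ?_⟩
    linear_combination s * q3 - t * p3
  push Not at c1
  by_contra! hn
  obtain ⟨A, B, hAB⟩ := hn
  have hA : ¬ (∀ b : S, A * b = b * A) := fun h => hAB (h B)
  have sub : ∀ t : F, ¬ (∀ b : S, (B - t • A) * b = b * (B - t • A)) := by
    intro t h
    have := h A
    rw [sub_mul, mul_sub, smul_mul_assoc, mul_smul_comm] at this
    exact hAB (sub_left_injective this).symm
  obtain ⟨x, hx, hAx⟩ := ess A hA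
  by_cases c2 : ∃ C : S, C.1 1 2 ≠ 0
  · obtain ⟨C, hC⟩ := c2
    have zz : ∀ x : S, (∀ b : S, x * b = b * x) → x.1 0 1 = 0 ∧ x.1 2 3 = 0 := by
      intro x hx
      have h := (comm _ _).1 (hx C)
      rw [c1 x hx] at h
      simp [hC] at h
      exact ⟨h.1, h.2.1⟩
    have ne : ∀ A : S, ¬ (∀ b : S, A * b = b * A) → A.1 0 1 ≠ 0 := by
      intro A hA h0
      obtain ⟨x, hx, hAx⟩ := ess A hA
      exact nz _ _ hAx (by simp [h0]) (by simp [zz x hx]) (by simp [h0, zz x hx])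
    refine ne _ (sub (B.1 0 1 / A.1 0 1)) ?_
    have := ne A hA
    simp [this]
  · push Not at c2
    have h1 := nz _ _ hAx (by simp [c2]) (by simp [c2])
    set p := A.1 0 1 * x.1 1 3 + A.1 0 2 * x.1 2 3 with hp
    set t := (B.1 0 1 * x.1 1 3 + B.1 0 2 * x.1 2 3) / p with ht
    obtain ⟨D, hD⟩ : ∃ D, D = B - t • A := ⟨_, rfl⟩
    have hDn := sub t
    rw [← hD] at hDn
    have hAD : A * D ≠ D * A := by
      intro h
      rw [hD, sub_mul, mul_sub, smul_mul_assoc, mul_smul_comm] at h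
      exact hAB (sub_left_injective h)
    obtain ⟨y, hy, hDy⟩ := ess D hDn
    have h3 := nz _ _ hDy (by simp [c2]) (by simp [c2])
    have h2 : D.1 0 1 * x.1 1 3 + D.1 0 2 * x.1 2 3 = 0 := by
      have e : t * p = B.1 0 1 * x.1 1 3 + B.1 0 2 * x.1 2 3 := by rw [ht]; field_simp
      have d1 : D.1 0 1 = B.1 0 1 - t * A.1 0 1 := by rw [hD]; simp
      have d2 : D.1 0 2 = B.1 0 2 - t * A.1 0 2 := by rw [hD]; simp
      rw [d1, d2]
      rw [hp] at e
      linear_combination -e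
    have hw : ¬ _ := fun h => hAD ((comm A D).2 ⟨by simp [c2], by simp [c2], h⟩)
    exact n4_pfaff _ _ _ _ _ _ _ _ _ _ _ _ _ _ _ _ hw
      ((comm _ _).1 (hx A)).2.2.symm ((comm _ _).1 (hx D)).2.2.symm
      ((comm _ _).1 (hy A)).2.2.symm ((comm _ _).1 (hy D)).2.2.symm
      ((comm _ _).1 (hx y)).2.2 h1 h2 h3
end

section
/- For every integer n > 6 there exists a torsion-free abelian group A of rank n (i.e., the ℚ-vector space ℚ ⊗_ℤ A has dimension n) such that the endomorphism ring End(A) of A is a non-commutative centrally essential ring. -/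
open scoped TensorProduct

namespace CEEnd

/-- The localization of `ℤ` at `p`, inside `ℚ`. -/
def L (p : Nat.Primes) : Subring ℚ :=
  haveI : Fact (p : ℕ).Prime := ⟨p.2⟩
  { carrier := {q | padicNorm p q ≤ 1}
    mul_mem' := by
      intro a b ha hb
      simp only [Set.mem_ofPred_eq, padicNorm.mul] at *
      exact mul_le_one₀ ha (padicNorm.nonneg _) hb
    one_mem' := by simp
    add_mem' := by
      intro a b ha hb
      exact le_trans padicNorm.nonarchimedean (max_le ha hb)
    zero_mem' := by simp
    neg_mem' := by
      intro a ha
      simpa using ha }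

lemma mem_L (p : Nat.Primes) (q : ℚ) : q ∈ L p ↔ padicNorm p q ≤ 1 := Iff.rfl

lemma finite_not_mem (q : ℚ) : {p : Nat.Primes | q ∉ L p}.Finite := by
  have h : ((q.den.primeFactors : Set ℕ)).Finite := Finset.finite_toSet _
  refine (h.preimage (f := fun p : Nat.Primes => (p : ℕ))
    (Nat.Primes.coe_nat_injective.injOn)).subset ?_
  intro p hp
  haveI : Fact (p : ℕ).Prime := ⟨p.2⟩
  simp only [Set.mem_preimage, Finset.mem_coe, Nat.mem_primeFactors]
  refine ⟨p.2, ?_, q.den_nz⟩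
  by_contra hd
  apply hp
  rw [mem_L]
  have h1 := (padicNorm.nat_eq_one_iff (p := p) q.den).2 hd
  have h2 := padicNorm.of_int (p := p) q.num
  rw [← Rat.num_div_den q, padicNorm.div, h1]
  simpa using h2

lemma prime_ne_zero (p : Nat.Primes) : ((p : ℕ) : ℚ) ≠ 0 := by
  exact_mod_cast p.2.ne_zero

lemma eq_zero_of_div (q : ℚ) (S : Set Nat.Primes) (hS : S.Infinite)
    (h : ∀ p ∈ S, q / (p : ℕ) ∈ L p) : q = 0 := by
  by_contra hq
  apply hS
  refine (finite_not_mem q⁻¹).subset ?_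
  intro p hp hq'
  haveI : Fact (p : ℕ).Prime := ⟨p.2⟩
  have h1 := (L p).mul_mem (h p hp) hq'
  rw [mem_L] at h1
  have : q / (p : ℕ) * q⁻¹ = ((p : ℕ) : ℚ)⁻¹ := by
    have := prime_ne_zero p
    field_simp
  rw [this, ← one_div, padicNorm.div, padicNorm.padicNorm_p_of_prime] at h1
  simp at h1
  exact absurd h1 (not_le.2 p.2.one_lt)

lemma poly_zero (q0 q1 q2 q3 : ℚ) (S : Set Nat.Primes) (hS : S.Infinite)
    (h : ∀ p ∈ S, (((p : ℕ) : ℚ) ^ 4)⁻¹ *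
      ((p : ℕ) ^ 3 * q0 - (p : ℕ) ^ 2 * q1 + (p : ℕ) * q2 - q3) ∈ L p) : q0 = 0 := by
  set F : Set Nat.Primes := {p | q0 ∉ L p} ∪ {p | q1 ∉ L p} ∪ {p | q2 ∉ L p} with hF
  have hFf : F.Finite :=
    ((finite_not_mem q0).union (finite_not_mem q1)).union (finite_not_mem q2)
  have hT : (S \ F).Infinite := hS.sdiff hFf
  have hm : ∀ p ∈ S \ F, q0 ∈ L p ∧ q1 ∈ L p ∧ q2 ∈ L p := by
    intro p hp
    have := hp.2
    simp only [hF, Set.mem_union, Set.mem_ofPred_eq] at this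
    tauto
  have hP : ∀ p : Nat.Primes, ((p : ℕ) : ℚ) ∈ L p := fun p => natCast_mem _ _
  have h3 : q3 = 0 := by
    refine eq_zero_of_div q3 _ hT fun p hp => ?_
    obtain ⟨m0, m1, m2⟩ := hm p hp
    have hp0 := prime_ne_zero p
    have e : q3 / (p : ℕ) = (p : ℕ) ^ 2 * q0 - (p : ℕ) * q1 + q2 - (p : ℕ) ^ 3 *
      ((((p : ℕ) : ℚ) ^ 4)⁻¹ *
      ((p : ℕ) ^ 3 * q0 - (p : ℕ) ^ 2 * q1 + (p : ℕ) * q2 - q3)) := by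
      field_simp; ring
    rw [e]
    exact sub_mem (add_mem (sub_mem (mul_mem (pow_mem (hP p) _) m0) (mul_mem (hP p) m1)) m2)
      (mul_mem (pow_mem (hP p) _) (h p hp.1))
  subst h3
  have h2 : q2 = 0 := by
    refine eq_zero_of_div q2 _ hT fun p hp => ?_
    obtain ⟨m0, m1, m2⟩ := hm p hp
    have hp0 := prime_ne_zero p
    have e : q2 / (p : ℕ) = q1 - (p : ℕ) * q0 + (p : ℕ) ^ 2 *
      ((((p : ℕ) : ℚ) ^ 4)⁻¹ *
      ((p : ℕ) ^ 3 * q0 - (p : ℕ) ^ 2 * q1 + (p : ℕ) * q2 - 0)) := by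
      field_simp; ring
    rw [e]
    exact add_mem (sub_mem m1 (mul_mem (hP p) m0))
      (mul_mem (pow_mem (hP p) _) (h p hp.1))
  subst h2
  have h1 : q1 = 0 := by
    refine eq_zero_of_div q1 _ hT fun p hp => ?_
    obtain ⟨m0, m1, m2⟩ := hm p hp
    have hp0 := prime_ne_zero p
    have e : q1 / (p : ℕ) = q0 - (p : ℕ) *
      ((((p : ℕ) : ℚ) ^ 4)⁻¹ *
      ((p : ℕ) ^ 3 * q0 - (p : ℕ) ^ 2 * q1 + (p : ℕ) * 0 - 0)) := by
      field_simp; ring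
    rw [e]
    exact sub_mem m0 (mul_mem (hP p) (h p hp.1))
  subst h1
  refine eq_zero_of_div q0 _ hS fun p hp => ?_
  have hp0 := prime_ne_zero p
  have e : q0 / (p : ℕ) = ((((p : ℕ) : ℚ) ^ 4)⁻¹ *
      ((p : ℕ) ^ 3 * q0 - (p : ℕ) ^ 2 * 0 + (p : ℕ) * 0 - 0)) := by
    field_simp; ring
  rw [e]
  exact h p hp

lemma inv_mem_L (p q : Nat.Primes) (h : p ≠ q) : ((p : ℕ) : ℚ)⁻¹ ∈ L q := by
  haveI : Fact (p : ℕ).Prime := ⟨p.2⟩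
  haveI : Fact (q : ℕ).Prime := ⟨q.2⟩
  have h1 : padicNorm q (p : ℕ) = 1 := by
    apply padicNorm.padicNorm_of_prime_of_ne
    intro h'
    exact h (Subtype.ext h'.symm)
  rw [mem_L, ← one_div, padicNorm.div, h1]
  simp

/-- The underlying space of the algebra with basis `1, a, b, a², b², t, y₁, …, yₘ`, where
`a³ = b³ = ab = t`, `ba = 0`, `yᵢ` annihilates the radical. -/
def V (m : ℕ) : Type := (Fin 6 → ℚ) × (Fin m → ℚ)

variable {m : ℕ}

instance : AddCommGroup (V m) := inferInstanceAs (AddCommGroup ((Fin 6 → ℚ) × (Fin m → ℚ)))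
instance : Module ℚ (V m) := inferInstanceAs (Module ℚ ((Fin 6 → ℚ) × (Fin m → ℚ)))

@[ext] lemma V.ext {v w : V m} (h0 : v.1 0 = w.1 0) (h1 : v.1 1 = w.1 1) (h2 : v.1 2 = w.1 2)
    (h3 : v.1 3 = w.1 3) (h4 : v.1 4 = w.1 4) (h5 : v.1 5 = w.1 5)
    (h : ∀ i, v.2 i = w.2 i) : v = w := by
  refine Prod.ext ?_ (funext h)
  funext i
  fin_cases i <;> assumption

@[simp] lemma add1 (v w : V m) (i) : (v + w).1 i = v.1 i + w.1 i := rfl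
@[simp] lemma add2 (v w : V m) (i) : (v + w).2 i = v.2 i + w.2 i := rfl
@[simp] lemma sub1 (v w : V m) (i) : (v - w).1 i = v.1 i - w.1 i := rfl
@[simp] lemma sub2 (v w : V m) (i) : (v - w).2 i = v.2 i - w.2 i := rfl
@[simp] lemma neg1 (v : V m) (i) : (-v).1 i = -v.1 i := rfl
@[simp] lemma neg2 (v : V m) (i) : (-v).2 i = -v.2 i := rfl
@[simp] lemma zero1 (i) : (0 : V m).1 i = 0 := rfl
@[simp] lemma zero2 (i) : (0 : V m).2 i = 0 := rfl
@[simp] lemma smul1 (q : ℚ) (v : V m) (i) : (q • v).1 i = q * v.1 i := rfl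
@[simp] lemma smul2 (q : ℚ) (v : V m) (i) : (q • v).2 i = q * v.2 i := rfl

instance : Mul (V m) := ⟨fun v w =>
  (![v.1 0 * w.1 0,
    v.1 0 * w.1 1 + v.1 1 * w.1 0,
    v.1 0 * w.1 2 + v.1 2 * w.1 0,
    v.1 0 * w.1 3 + v.1 3 * w.1 0 + v.1 1 * w.1 1,
    v.1 0 * w.1 4 + v.1 4 * w.1 0 + v.1 2 * w.1 2,
    v.1 0 * w.1 5 + v.1 5 * w.1 0 + v.1 1 * w.1 3 + v.1 3 * w.1 1 + v.1 2 * w.1 4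
      + v.1 4 * w.1 2 + v.1 1 * w.1 2],
   fun i => v.1 0 * w.2 i + v.2 i * w.1 0)⟩

instance : One (V m) := ⟨(![1, 0, 0, 0, 0, 0], fun _ => 0)⟩

@[simp] lemma one10 : (1 : V m).1 0 = 1 := rfl
@[simp] lemma one11 : (1 : V m).1 1 = 0 := rfl
@[simp] lemma one12 : (1 : V m).1 2 = 0 := rfl
@[simp] lemma one13 : (1 : V m).1 3 = 0 := rfl
@[simp] lemma one14 : (1 : V m).1 4 = 0 := rfl
@[simp] lemma one15 : (1 : V m).1 5 = 0 := rfl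
@[simp] lemma one2 (i) : (1 : V m).2 i = 0 := rfl
@[simp] lemma mul10 (v w : V m) : (v * w).1 0 = v.1 0 * w.1 0 := rfl
@[simp] lemma mul11 (v w : V m) : (v * w).1 1 = v.1 0 * w.1 1 + v.1 1 * w.1 0 := rfl
@[simp] lemma mul12 (v w : V m) : (v * w).1 2 = v.1 0 * w.1 2 + v.1 2 * w.1 0 := rfl
@[simp] lemma mul13 (v w : V m) : (v * w).1 3 =
    v.1 0 * w.1 3 + v.1 3 * w.1 0 + v.1 1 * w.1 1 := rfl
@[simp] lemma mul14 (v w : V m) : (v * w).1 4 =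
    v.1 0 * w.1 4 + v.1 4 * w.1 0 + v.1 2 * w.1 2 := rfl
@[simp] lemma mul15 (v w : V m) : (v * w).1 5 =
    v.1 0 * w.1 5 + v.1 5 * w.1 0 + v.1 1 * w.1 3 + v.1 3 * w.1 1 + v.1 2 * w.1 4
      + v.1 4 * w.1 2 + v.1 1 * w.1 2 := rfl
@[simp] lemma mul2 (v w : V m) (i) : (v * w).2 i = v.1 0 * w.2 i + v.2 i * w.1 0 := rfl

instance : Ring (V m) :=
  { (inferInstance : AddCommGroup (V m)), (inferInstance : Mul (V m)),
    (inferInstance : One (V m)) with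
    left_distrib := by intro a b c; ext <;> simp <;> ring
    right_distrib := by intro a b c; ext <;> simp <;> ring
    zero_mul := by intro a; ext <;> simp
    mul_zero := by intro a; ext <;> simp
    mul_assoc := by intro a b c; ext <;> simp <;> ring
    one_mul := by intro a; ext <;> simp
    mul_one := by intro a; ext <;> simp }

instance : Algebra ℚ (V m) := Algebra.ofModule
  (by intro q v w; ext <;> simp <;> ring) (by intro q v w; ext <;> simp <;> ring)

/-- The localized order. -/
def Rp (m : ℕ) (p : Nat.Primes) : Subring (V m) where
  carrier := {v | (∀ i, v.1 i ∈ L p) ∧ ∀ i, v.2 i ∈ L p}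
  mul_mem' := by
    rintro v w ⟨hv, hv'⟩ ⟨hw, hw'⟩
    refine ⟨fun i => ?_, fun i => ?_⟩
    · have M : ∀ j k, v.1 j * w.1 k ∈ L p := fun j k => (L p).mul_mem (hv j) (hw k)
      match i with
      | 0 => exact M 0 0
      | 1 => exact (L p).add_mem (M 0 1) (M 1 0)
      | 2 => exact (L p).add_mem (M 0 2) (M 2 0)
      | 3 => exact (L p).add_mem ((L p).add_mem (M 0 3) (M 3 0)) (M 1 1)
      | 4 => exact (L p).add_mem ((L p).add_mem (M 0 4) (M 4 0)) (M 2 2)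
      | 5 =>
        exact (L p).add_mem ((L p).add_mem ((L p).add_mem ((L p).add_mem ((L p).add_mem
          ((L p).add_mem (M 0 5) (M 5 0)) (M 1 3)) (M 3 1)) (M 2 4)) (M 4 2)) (M 1 2)
    · exact (L p).add_mem ((L p).mul_mem (hv _) (hw' _)) ((L p).mul_mem (hv' _) (hw _))
  one_mem' := by
    refine ⟨fun i => ?_, fun i => ?_⟩
    · match i with
      | 0 => exact (L p).one_mem
      | 1 => exact (L p).zero_mem
      | 2 => exact (L p).zero_mem
      | 3 => exact (L p).zero_mem
      | 4 => exact (L p).zero_mem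
      | 5 => exact (L p).zero_mem
    · exact (L p).zero_mem
  add_mem' := by
    rintro v w ⟨hv, hv'⟩ ⟨hw, hw'⟩
    exact ⟨fun i => (L p).add_mem (hv _) (hw _), fun i => (L p).add_mem (hv' _) (hw' _)⟩
  zero_mem' := ⟨fun i => (L p).zero_mem, fun i => (L p).zero_mem⟩
  neg_mem' := by
    rintro v ⟨hv, hv'⟩
    exact ⟨fun i => (L p).neg_mem (hv _), fun i => (L p).neg_mem (hv' _)⟩

lemma smul_mem_Rp {p : Nat.Primes} {q : ℚ} (hq : q ∈ L p) {v : V m} (hv : v ∈ Rp m p) :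
    q • v ∈ Rp m p :=
  ⟨fun i => (L p).mul_mem hq (hv.1 i), fun i => (L p).mul_mem hq (hv.2 i)⟩

/-- Integral vectors. -/
def ofInt (z : (Fin 6 → ℤ) × (Fin m → ℤ)) : V m := (fun i => z.1 i, fun i => z.2 i)

@[simp] lemma ofInt1 (z : (Fin 6 → ℤ) × (Fin m → ℤ)) (i) : (ofInt z).1 i = z.1 i := rfl
@[simp] lemma ofInt2 (z : (Fin 6 → ℤ) × (Fin m → ℤ)) (i) : (ofInt z).2 i = z.2 i := rfl

lemma ofInt_mem (z : (Fin 6 → ℤ) × (Fin m → ℤ)) (p : Nat.Primes) : ofInt z ∈ Rp m p :=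
  ⟨fun _ => intCast_mem _ _, fun _ => intCast_mem _ _⟩

/-- The radical part of an integral vector. -/
def rad (z : (Fin 6 → ℤ) × (Fin m → ℤ)) : V m := ofInt (Function.update z.1 0 0, z.2)

lemma rad_pow (z : (Fin 6 → ℤ) × (Fin m → ℤ)) : rad z * (rad z * (rad z * rad z)) = 0 := by
  have : (rad z).1 0 = 0 := by simp [rad]
  ext <;> simp [this]

lemma exists_mult (v : V m) : ∃ (N : ℕ) (z : (Fin 6 → ℤ) × (Fin m → ℤ)),
    N ≠ 0 ∧ (N : ℚ) • v = ofInt z := by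
  have key : ∀ (N : ℕ) (q : ℚ), q.den ∣ N → ∃ z : ℤ, (N : ℚ) * q = z := by
    rintro N q ⟨k, rfl⟩
    refine ⟨k * q.num, ?_⟩
    push_cast
    rw [mul_comm (q.den : ℚ), mul_assoc, mul_comm (q.den : ℚ), Rat.mul_den_eq_num]
  set N := (∏ i, (v.1 i).den) * ∏ i, (v.2 i).den with hN
  have h1 : ∀ i, ∃ z : ℤ, (N : ℚ) * v.1 i = z := fun i => key _ _
    ((Finset.dvd_prod_of_mem (fun i => (v.1 i).den) (Finset.mem_univ i)).trans
      (Dvd.intro _ rfl))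
  have h2 : ∀ i, ∃ z : ℤ, (N : ℚ) * v.2 i = z := fun i => key _ _
    ((Finset.dvd_prod_of_mem (fun i => (v.2 i).den) (Finset.mem_univ i)).trans
      (Dvd.intro_left _ rfl))
  choose z1 hz1 using h1
  choose z2 hz2 using h2
  refine ⟨N, (z1, z2), ?_, ?_⟩
  · rw [hN]
    exact mul_ne_zero (Finset.prod_ne_zero_iff.2 fun i _ => (v.1 i).den_nz)
      (Finset.prod_ne_zero_iff.2 fun i _ => (v.2 i).den_nz)
  · exact Prod.ext (funext hz1) (funext hz2)

lemma ofInt_eq (z : (Fin 6 → ℤ) × (Fin m → ℤ)) : ofInt z = z.1 0 • (1 : V m) + rad z := by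
  rw [← Int.cast_smul_eq_zsmul ℚ]
  ext <;> simp [rad]

lemma exists_label (m : ℕ) : ∃ Y : Nat.Primes → (Fin 6 → ℤ) × (Fin m → ℤ),
    ∀ z, {p | Y p = z}.Infinite := by
  haveI : Infinite Nat.Primes := inferInstance
  obtain ⟨d⟩ := nonempty_denumerable Nat.Primes
  obtain ⟨f, hf⟩ := exists_surjective_nat (((Fin 6 → ℤ) × (Fin m → ℤ)) × ℕ)
  refine ⟨fun p => (f (Denumerable.eqv Nat.Primes p)).1, fun z hz => ?_⟩
  have : Set.SurjOn (fun p => (f (Denumerable.eqv Nat.Primes p)).2)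
      {p | (f (Denumerable.eqv Nat.Primes p)).1 = z} (Set.univ : Set ℕ) := by
    intro k _
    obtain ⟨j, hj⟩ := hf (z, k)
    exact ⟨(Denumerable.eqv Nat.Primes).symm j, by simp [hj], by simp [hj]⟩
  exact Set.infinite_univ (hz.of_surjOn _ this)

/-- The labelling of primes by radical elements. -/
noncomputable def Y (m : ℕ) : Nat.Primes → (Fin 6 → ℤ) × (Fin m → ℤ) := (exists_label m).choose

lemma Y_inf (z : (Fin 6 → ℤ) × (Fin m → ℤ)) : {p | Y m p = z}.Infinite :=
  (exists_label m).choose_spec z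

/-- The element `p⁴ (p + y)⁻¹` -/
def W (P : ℚ) (y : V m) : V m := P ^ 3 • (1 : V m) - P ^ 2 • y + P • (y * y) - y * (y * y)

lemma W_spec (P : ℚ) (y : V m) (hy : y * (y * (y * y)) = 0) :
    (P • (1 : V m) + y) * W P y = P ^ 4 • (1 : V m) := by
  have h : (P • (1 : V m) + y) * W P y = P ^ 4 • (1 : V m) - y * (y * (y * y)) := by
    simp only [W, mul_add, mul_sub, add_mul, smul_mul_assoc, mul_smul_comm, one_mul, mul_one,
      smul_add, smul_sub, smul_smul]
    module
  rw [h, hy, sub_zero]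

noncomputable def A (m : ℕ) : AddSubgroup (V m) where
  carrier := {v | ∀ p : Nat.Primes, v * W (p : ℕ) (rad (Y m p)) ∈ Rp m p}
  add_mem' := by
    intro a b ha hb p
    rw [add_mul]
    exact add_mem (ha p) (hb p)
  zero_mem' := by
    intro p
    rw [zero_mul]
    exact zero_mem _
  neg_mem' := by
    intro a ha p
    rw [neg_mul]
    exact neg_mem (ha p)

lemma mem_A (v : V m) : v ∈ A m ↔ ∀ p : Nat.Primes, v * W (p : ℕ) (rad (Y m p)) ∈ Rp m p :=
  Iff.rfl

lemma W_mem (p q : Nat.Primes) (z) : W (p : ℕ) (rad z) ∈ Rp m q := by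
  have h : rad z ∈ Rp m q := ofInt_mem _ _
  have hp : ((p : ℕ) : ℚ) ∈ L q := natCast_mem _ _
  exact sub_mem (add_mem (sub_mem (smul_mem_Rp (pow_mem hp _) (one_mem _))
    (smul_mem_Rp (pow_mem hp _) h)) (smul_mem_Rp hp (mul_mem h h))) (mul_mem h (mul_mem h h))

lemma ofInt_mul_mem (z) (v : V m) (hv : v ∈ A m) : ofInt z * v ∈ A m := by
  intro p
  rw [mul_assoc]
  exact mul_mem (ofInt_mem z p) (hv p)

lemma ofInt_mem_A (z) : ofInt z ∈ A m := by
  intro p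
  exact mul_mem (ofInt_mem z p) (W_mem _ _ _)

lemma one_mem_A : (1 : V m) ∈ A m := by
  intro p
  exact mul_mem (one_mem _) (W_mem _ _ _)

/-- The special elements of `A`. -/
noncomputable def U (m : ℕ) (p : Nat.Primes) : V m :=
  (((p : ℕ) : ℚ) ^ 4)⁻¹ • (((p : ℕ) : ℚ) • (1 : V m) + rad (Y m p))

lemma U_W (p : Nat.Primes) : U m p * W (p : ℕ) (rad (Y m p)) = 1 := by
  have := prime_ne_zero p
  rw [U, smul_mul_assoc, W_spec _ _ (rad_pow _), smul_smul, inv_mul_cancel₀ (by positivity),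
    one_smul]

lemma U_mem (p : Nat.Primes) : U m p ∈ A m := by
  intro q
  by_cases h : p = q
  · subst h
    rw [U_W]
    exact one_mem _
  · refine mul_mem (smul_mem_Rp ?_ ?_) (W_mem _ _ _)
    · rw [← inv_pow]
      exact pow_mem (inv_mem_L p q h) _
    · exact add_mem (smul_mem_Rp (natCast_mem _ _) (one_mem _)) (ofInt_mem _ _)

lemma V_eq_zero (z y : V m) (S : Set Nat.Primes) (hS : S.Infinite)
    (h : ∀ p ∈ S, (((p : ℕ) : ℚ) ^ 4)⁻¹ • (z * W (p : ℕ) y) ∈ Rp m p) : z = 0 := by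
  have e : ∀ P : ℚ, z * W P y = P ^ 3 • z - P ^ 2 • (z * y) + P • (z * (y * y))
      - z * (y * (y * y)) := by
    intro P
    simp only [W, mul_add, mul_sub, mul_smul_comm, mul_one]
  have h1 : ∀ i, z.1 i = 0 := fun i =>
    poly_zero (z.1 i) ((z * y).1 i) ((z * (y * y)).1 i) ((z * (y * (y * y))).1 i) S hS
      fun p hp => by
        have := (h p hp).1 i
        rw [e] at this
        exact this
  have h2 : ∀ i, z.2 i = 0 := fun i =>
    poly_zero (z.2 i) ((z * y).2 i) ((z * (y * y)).2 i) ((z * (y * (y * y))).2 i) S hS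
      fun p hp => by
        have := (h p hp).2 i
        rw [e] at this
        exact this
  exact Prod.ext (funext h1) (funext h2)

/-- One as an element of `A`. -/
def oneA (m : ℕ) : A m := ⟨1, one_mem_A⟩

lemma end_rad (φ : AddMonoid.End (A m)) (z) :
    (φ ⟨rad z, ofInt_mem_A _⟩ : V m) = (φ (oneA m) : V m) * rad z := by
  set e : V m := (φ (oneA m) : V m) with he
  set r : V m := (φ ⟨rad z, ofInt_mem_A _⟩ : V m) with hr
  obtain ⟨N, z', hN, hz'⟩ := exists_mult e
  have key : (N : ℚ) • (r - e * rad z) = 0 := by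
    refine V_eq_zero _ (rad z) _ (Y_inf z) ?_
    intro p hp
    have hp : Y m p = z := hp
    have hp0 := prime_ne_zero p
    have hU : ((p : ℕ) ^ 4) • (⟨U m p, U_mem p⟩ : A m) =
        (p : ℕ) • oneA m + ⟨rad z, ofInt_mem_A _⟩ := by
      apply Subtype.ext
      rw [AddSubgroup.coe_add, AddSubgroup.coe_nsmul, AddSubgroup.coe_nsmul]
      simp only [oneA]
      rw [← Nat.cast_smul_eq_nsmul ℚ, ← Nat.cast_smul_eq_nsmul ℚ, U, hp, smul_smul]
      push_cast
      rw [mul_inv_cancel₀ (by positivity), one_smul]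
    have h1 := congrArg (fun x : A m => (x : V m)) (congrArg φ hU)
    simp only [map_add, map_nsmul, AddSubgroup.coe_add, AddSubgroup.coe_nsmul] at h1
    rw [← Nat.cast_smul_eq_nsmul ℚ, ← Nat.cast_smul_eq_nsmul ℚ, ← he, ← hr] at h1
    have h2 : r - e * rad z = (((p : ℕ) : ℚ) ^ 4) •
        ((φ ⟨U m p, U_mem p⟩ : V m) - e * U m p) := by
      have hUU : (((p : ℕ) : ℚ) ^ 4) • U m p = ((p : ℕ) : ℚ) • (1 : V m) + rad z := by
        rw [U, smul_smul, mul_inv_cancel₀ (by positivity), one_smul, hp]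
      rw [smul_sub, ← mul_smul_comm, hUU]
      push_cast at h1
      rw [h1, mul_add, mul_smul_comm, mul_one]
      abel
    have h3 : (((p : ℕ) : ℚ) ^ 4)⁻¹ • (((N : ℚ) • (r - e * rad z)) * W (p : ℕ) (rad z)) =
        (N : ℚ) • ((φ ⟨U m p, U_mem p⟩ : V m) * W (p : ℕ) (rad (Y m p))) - ofInt z' := by
      have h4 := U_W (m := m) p
      rw [h2, ← hz', smul_mul_assoc, smul_mul_assoc, sub_mul, mul_assoc, ← hp, h4, mul_one,
        smul_comm (N : ℚ), smul_smul, inv_mul_cancel₀ (by positivity), one_smul, smul_sub]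
    rw [h3]
    exact sub_mem (smul_mem_Rp (natCast_mem _ _) ((φ ⟨U m p, U_mem p⟩).2 p)) (ofInt_mem _ _)
  have := (smul_eq_zero.1 key).resolve_left (by exact_mod_cast hN)
  exact sub_eq_zero.1 this

lemma end_apply (φ : AddMonoid.End (A m)) (a : A m) :
    (φ a : V m) = (φ (oneA m) : V m) * a := by
  obtain ⟨N, z, hN, hz⟩ := exists_mult (a : V m)
  have h : N • a = z.1 0 • oneA m + ⟨rad z, ofInt_mem_A _⟩ := by
    apply Subtype.ext
    rw [AddSubgroup.coe_add, AddSubgroup.coe_nsmul, AddSubgroup.coe_zsmul,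
      ← Nat.cast_smul_eq_nsmul ℚ, hz, ofInt_eq]
    rfl
  have h1 := congrArg (fun x : A m => (x : V m)) (congrArg φ h)
  simp only [map_add, map_nsmul, map_zsmul, AddSubgroup.coe_add, AddSubgroup.coe_nsmul,
    AddSubgroup.coe_zsmul, end_rad] at h1
  have h2 : (N : ℚ) • ((φ a : V m) - (φ (oneA m) : V m) * a) = 0 := by
    rw [smul_sub, Nat.cast_smul_eq_nsmul, h1, ← mul_smul_comm, hz, ofInt_eq, mul_add,
      mul_smul_comm, mul_one, sub_self]
  exact sub_eq_zero.1 ((smul_eq_zero.1 h2).resolve_left (by exact_mod_cast hN))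

lemma end_ext {φ ψ : AddMonoid.End (A m)} (h : (φ (oneA m) : V m) = ψ (oneA m)) : φ = ψ := by
  ext a : 1
  apply Subtype.ext
  rw [end_apply φ, end_apply ψ, h]

lemma mul_one_val (φ ψ : AddMonoid.End (A m)) :
    ((φ * ψ) (oneA m) : V m) = (φ (oneA m) : V m) * ψ (oneA m) := by
  exact end_apply φ (ψ (oneA m))

lemma central (φ : AddMonoid.End (A m)) (h1 : (φ (oneA m) : V m).1 1 = 0)
    (h2 : (φ (oneA m) : V m).1 2 = 0) (ψ : AddMonoid.End (A m)) : φ * ψ = ψ * φ := by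
  apply end_ext
  rw [mul_one_val, mul_one_val]
  ext <;> simp [h1, h2] <;> ring

/-- Left multiplication by an integral vector. -/
def lm (z : (Fin 6 → ℤ) × (Fin m → ℤ)) : AddMonoid.End (A m) where
  toFun a := ⟨ofInt z * a, ofInt_mul_mem z a a.2⟩
  map_zero' := by simp
  map_add' a b := by
    apply Subtype.ext
    simp [mul_add]

lemma lm_one (z : (Fin 6 → ℤ) × (Fin m → ℤ)) : (lm z (oneA m) : V m) = ofInt z :=
  mul_one (ofInt z)

lemma noncomm (m : ℕ) : ¬ (∀ f g : AddMonoid.End (A m), f * g = g * f) := by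
  intro h
  have h1 := h (lm (![0, 1, 0, 0, 0, 0], 0)) (lm (![0, 0, 1, 0, 0, 0], 0))
  have h2 := congrArg (fun f : AddMonoid.End (A m) => (f (oneA m) : V m).1 5) h1
  simp only [mul_one_val, lm_one] at h2
  simp at h2

lemma ce (m : ℕ) : IsCentrallyEssential (AddMonoid.End (A m)) := by
  right
  intro φ hφ
  have main : ∀ z : (Fin 6 → ℤ) × (Fin m → ℤ), z.1 0 = 0 → z.1 1 = 0 → z.1 2 = 0 →
      ((φ (oneA m) : V m) * ofInt z).1 5 ≠ 0 →
      ∃ x y : AddMonoid.End (A m), (∀ b, x * b = b * x) ∧ (∀ b, y * b = b * y) ∧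
        x ≠ 0 ∧ y ≠ 0 ∧ φ * x = y := by
    intro z h0 h1 h2 h5
    have hy : φ * lm z ≠ 0 := by
      intro h
      apply h5
      rw [← lm_one, ← mul_one_val, h]
      rfl
    refine ⟨lm z, φ * lm z, central _ ?_ ?_, central _ ?_ ?_, ?_, hy, rfl⟩
    · rw [lm_one]; simp [h1]
    · rw [lm_one]; simp [h2]
    · rw [mul_one_val, lm_one]; simp [h0, h1]
    · rw [mul_one_val, lm_one]; simp [h0, h2]
    · intro h
      exact hy (by rw [h, mul_zero])
  by_cases h1 : (φ (oneA m) : V m).1 1 = 0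
  · by_cases h2 : (φ (oneA m) : V m).1 2 = 0
    · exact absurd (central φ h1 h2) hφ
    · exact main (![0, 0, 0, 0, 1, 0], 0) rfl rfl rfl (by simpa using h2)
  · exact main (![0, 0, 0, 1, 0, 0], 0) rfl rfl rfl (by simpa using h1)

lemma rank_A (m : ℕ) : Module.finrank ℚ (ℚ ⊗[ℤ] (A m)) = 6 + m := by
  have hloc : IsLocalizedModule (nonZeroDivisors ℤ) (A m).subtype.toIntLinearMap := by
    refine ⟨?_, ?_, ?_⟩
    · intro x
      have hx : ((x : ℤ) : ℚ) ≠ 0 := by exact_mod_cast nonZeroDivisors.ne_zero x.2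
      rw [Module.End.isUnit_iff]
      refine ⟨fun a b h => ?_, fun a => ⟨((x : ℤ) : ℚ)⁻¹ • a, ?_⟩⟩
      · simp only [Module.algebraMap_end_apply, ← Int.cast_smul_eq_zsmul ℚ] at h
        exact smul_right_injective _ hx h
      · simp only [Module.algebraMap_end_apply, ← Int.cast_smul_eq_zsmul ℚ]
        rw [smul_smul, mul_inv_cancel₀ hx, one_smul]
    · intro v
      obtain ⟨N, z, hN, hz⟩ := exists_mult v
      refine ⟨(⟨ofInt z, ofInt_mem_A z⟩, ⟨(N : ℤ), mem_nonZeroDivisors_of_ne_zero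
        (by exact_mod_cast hN)⟩), ?_⟩
      change (N : ℤ) • v = ofInt z
      rw [← hz, ← Int.cast_smul_eq_zsmul ℚ]
      simp
    · intro a b h
      exact ⟨1, by rw [Subtype.ext h]⟩
  have hb : IsBaseChange ℚ (A m).subtype.toIntLinearMap :=
    (isLocalizedModule_iff_isBaseChange (nonZeroDivisors ℤ) ℚ _).1 hloc
  rw [hb.equiv.finrank_eq]
  change Module.finrank ℚ ((Fin 6 → ℚ) × (Fin m → ℚ)) = 6 + m
  simp

lemma torsion_free (m : ℕ) (k : ℤ) (a : A m) (h : k • a = 0) : k = 0 ∨ a = 0 := by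
  have h1 := congrArg (fun x : A m => (x : V m)) h
  simp only [AddSubgroup.coe_zsmul, AddSubgroup.coe_zero, ← Int.cast_smul_eq_zsmul ℚ] at h1
  rcases smul_eq_zero.1 h1 with h2 | h2
  · left; exact_mod_cast h2
  · right; exact Subtype.ext h2

end CEEnd

/-- For every `n > 6` there is a torsion-free abelian group of rank `n` whose endomorphism
ring is a non-commutative centrally essential ring. -/
theorem exists_torsionFree_rank_n_noncommutative_centrallyEssential_endRing
    (n : ℕ) (hn : 6 < n) :
    ∃ (A : Type) (_ : AddCommGroup A),
      (∀ (k : ℤ) (a : A), k • a = 0 → k = 0 ∨ a = 0) ∧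
      Module.finrank ℚ (ℚ ⊗[ℤ] A) = n ∧
      ¬ (∀ f g : AddMonoid.End A, f * g = g * f) ∧
      IsCentrallyEssential (AddMonoid.End A) := by
  obtain ⟨m, rfl⟩ : ∃ m, n = 6 + m := ⟨n - 6, by omega⟩
  exact ⟨CEEnd.A m, inferInstance, CEEnd.torsion_free m, CEEnd.rank_A m, CEEnd.noncomm m,
    CEEnd.ce m⟩
end
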